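/- Let ∅ ≠ E ⊂ X be a closed and porous set, and let α < 0 and 1 < p < ∞ be such that the weight w = δ_E^{-α} belongs to the Muckenhoupt class A_p. Then codim_A(E) > α/(1−p). -/

import Mathlib

open MeasureTheory Metric Set
open scoped ENNReal NNReal

namespace ApDistance

noncomputable section

variable {X : Type*} [MetricSpace X] [MeasurableSpace X] [BorelSpace X]

/-- All balls of positive radius have positive and finite measure. -/
def BallsPosFinite (μ : Measure X) : Prop :=
  ∀ (x : X) (r : ℝ), 0 < r → 0 < μ (ball x r) ∧ μ (ball x r) < ∞

/-- The measure `μ` is doubling with constant `C`. -/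
def DoublingWith (μ : Measure X) (C : ℝ) : Prop :=
  ∀ (x : X) (r : ℝ), 0 < r → μ (ball x (2 * r)) ≤ ENNReal.ofReal C * μ (ball x r)

/-- The measure `μ` is doubling. -/
def Doubling (μ : Measure X) : Prop :=
  ∃ C : ℝ, 0 < C ∧ DoublingWith μ C

/-- The (quantitative) reverse doubling condition with exponent `η`. -/
def ReverseDoubling (μ : Measure X) (η : ℝ) : Prop :=
  ∃ C : ℝ, 0 < C ∧ ∀ (x y : X) (r R : ℝ), 0 < r → 0 < R → ball y r ⊆ ball x R →
    μ (ball y r) ≤ ENNReal.ofReal (C * (r / R) ^ η) * μ (ball x R)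

/-- Standing assumptions (S1)-(S2): `X` is unbounded, points have measure zero,
and all annuli are nonempty. -/
def StandingAssumptions (μ : Measure X) : Prop :=
  ¬ Bornology.IsBounded (univ : Set X) ∧ (∀ x : X, μ {x} = 0) ∧
    ∀ (x : X) (r R : ℝ), 0 < r → r < R → (ball x R \ ball x r).Nonempty

/-- Ahlfors `Q`-regularity of the metric measure space. -/
def AhlforsRegular (μ : Measure X) (Q : ℝ) : Prop :=
  ∃ C : ℝ, 1 ≤ C ∧ ∀ (x : X) (r : ℝ), 0 < r → ENNReal.ofReal r < EMetric.diam (univ : Set X) →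
    ENNReal.ofReal (C⁻¹ * r ^ Q) ≤ μ (ball x r) ∧ μ (ball x r) ≤ ENNReal.ofReal (C * r ^ Q)

/-- The set of admissible exponents in the definition of the (upper) Assouad dimension:
`E ∩ B(x,R)` can be covered by at most `C (R/r)^s` balls of radius `r`. -/
def assouadDimBddSet (E : Set X) : Set ℝ :=
  {s : ℝ | 0 ≤ s ∧ ∃ C : ℝ, 1 ≤ C ∧ ∀ x ∈ E, ∀ r R : ℝ, 0 < r → r < R →
    ENNReal.ofReal R < 2 * EMetric.diam (univ : Set X) →
    ∃ F : Finset X, (F.card : ℝ) ≤ C * (R / r) ^ s ∧ E ∩ ball x R ⊆ ⋃ y ∈ F, ball y r}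

/-- The (upper) Assouad dimension of a set `E`. -/
def assouadDim (E : Set X) : ℝ := sInf (assouadDimBddSet E)

/-- The set of admissible exponents in the definition of the lower Assouad codimension. -/
def assouadCodimBddSet (μ : Measure X) (E : Set X) : Set ℝ :=
  {ρ : ℝ | 0 ≤ ρ ∧ ∃ C : ℝ, 1 ≤ C ∧ ∀ x ∈ E, ∀ r R : ℝ, 0 < r → r < R →
    ENNReal.ofReal R < 2 * EMetric.diam (univ : Set X) →
    μ ({y : X | infDist y E < r} ∩ ball x R) ≤
      ENNReal.ofReal (C * (r / R) ^ ρ) * μ (ball x R)}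

/-- The lower Assouad codimension of a set `E` with respect to `μ`. -/
def assouadCodim (μ : Measure X) (E : Set X) : ℝ := sSup (assouadCodimBddSet μ E)

/-- Porosity of a set `E ⊆ X`. -/
def IsPorous (E : Set X) : Prop :=
  ∃ c : ℝ, 0 < c ∧ c < 1 ∧ ∀ x ∈ E, ∀ r : ℝ, 0 < r →
    ENNReal.ofReal r < 2 * EMetric.diam (univ : Set X) →
    ∃ y : X, ball y (c * r) ⊆ ball x r \ E

/-- A weight: measurable, a.e. positive and finite, locally integrable on balls. -/
def IsWeight (μ : Measure X) (w : X → ℝ≥0∞) : Prop :=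
  Measurable w ∧ (∀ᵐ x ∂μ, 0 < w x ∧ w x ≠ ∞) ∧
    ∀ (x : X) (r : ℝ), 0 < r → ∫⁻ y in ball x r, w y ∂μ ≠ ∞

/-- Membership in the Muckenhoupt class `A_p`, `1 < p < ∞`. -/
def MemAp (μ : Measure X) (w : X → ℝ≥0∞) (p : ℝ) : Prop :=
  IsWeight μ w ∧ ∃ A : ℝ, 0 < A ∧ ∀ (x : X) (r : ℝ), 0 < r →
    ((∫⁻ y in ball x r, w y ∂μ) / μ (ball x r)) *
      ((∫⁻ y in ball x r, w y ^ (-(1 / (p - 1))) ∂μ) / μ (ball x r)) ^ (p - 1) ≤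
      ENNReal.ofReal A

/-- Membership in the Muckenhoupt class `A_1`. -/
def MemA1 (μ : Measure X) (w : X → ℝ≥0∞) : Prop :=
  IsWeight μ w ∧ ∃ A : ℝ, 0 < A ∧ ∀ (x : X) (r : ℝ), 0 < r →
    ((∫⁻ y in ball x r, w y ∂μ) / μ (ball x r)) *
      essSup (fun y => (w y)⁻¹) (μ.restrict (ball x r)) ≤ ENNReal.ofReal A

/-- Membership in the Muckenhoupt class `A_∞`. -/
def MemAinfty (μ : Measure X) (w : X → ℝ≥0∞) : Prop :=
  IsWeight μ w ∧ ∃ C d : ℝ, 0 < C ∧ 0 < d ∧ ∀ (x : X) (r : ℝ), 0 < r →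
    ∀ F : Set X, MeasurableSet F → F ⊆ ball x r →
      ∫⁻ y in F, w y ∂μ ≤
        ENNReal.ofReal C * (μ F / μ (ball x r)) ^ d * ∫⁻ y in ball x r, w y ∂μ

/-- The weight `w = δ_E^{-α} = dist(·,E)^{-α}` (with values in `ℝ≥0∞`). -/
def distWeight (E : Set X) (α : ℝ) : X → ℝ≥0∞ :=
  fun x => ENNReal.ofReal (infDist x E) ^ (-α)

/-- The Aikawa condition with exponent `α` and constant `C`. -/
def AikawaCondition (μ : Measure X) (E : Set X) (α C : ℝ) : Prop :=
  ∀ x ∈ E, ∀ r : ℝ, 0 < r → ENNReal.ofReal r < 2 * EMetric.diam (univ : Set X) →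
    ∫⁻ y in ball x r, ENNReal.ofReal (infDist y E) ^ (-α) ∂μ ≤
      ENNReal.ofReal (C * r ^ (-α)) * μ (ball x r)

/-- The Riesz potential `I_s f`. -/
def rieszPotential (μ : Measure X) (s : ℝ) (f : X → ℝ≥0∞) (x : X) : ℝ≥0∞ :=
  ∫⁻ y, f y * ENNReal.ofReal (dist x y ^ s) / μ (ball x (dist x y)) ∂μ

/-- `Lip_0(X)`: Lipschitz functions vanishing outside some ball. -/
def MemLip0 (f : X → ℝ) : Prop :=
  (∃ K : ℝ≥0, LipschitzWith K f) ∧ ∃ (x : X) (r : ℝ), ∀ y : X, y ∉ ball x r → f y = 0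

/-- The `λ`-chain condition. -/
def ChainCondition (X : Type*) [MetricSpace X] (lam : ℝ) : Prop :=
  ∃ M : ℝ, 1 ≤ M ∧ ∀ (x : X) (r R : ℝ), 0 < r → r < R →
    ∃ (k : ℕ) (c : ℕ → X) (ρ : ℕ → ℝ),
      (∀ i ≤ k, 0 < ρ i) ∧
      ball (c 0) (lam * ρ 0) ⊆ (ball x R)ᶜ ∧
      ball (c k) (lam * ρ k) ⊆ ball x r ∧
      (∀ i ≤ k,
        M⁻¹ * Metric.diam (ball (c i) (lam * ρ i)) ≤ infDist x (ball (c i) (lam * ρ i)) ∧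
        infDist x (ball (c i) (lam * ρ i)) ≤ M * Metric.diam (ball (c i) (lam * ρ i))) ∧
      (∀ i < k, ∃ (z : X) (t : ℝ), 0 < t ∧
        ball z t ⊆ ball (c i) (ρ i) ∩ ball (c (i + 1)) (ρ (i + 1)) ∧
        ball (c i) (ρ i) ∪ ball (c (i + 1)) (ρ (i + 1)) ⊆ ball z (M * t)) ∧
      (∀ y : X, (({i : ℕ | i ≤ k ∧ y ∈ ball (c i) (lam * ρ i)}).ncard : ℝ) ≤ M)

/-- The inner integral appearing in fractional Hardy–Sobolev inequalities:
`y ↦ ∫_X |f(y)-f(z)|^t / (d(y,z)^{st} μ(B(y,d(y,z)))) dμ(z)`. -/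
def fracEnergyKernel (μ : Measure X) (s t : ℝ) (f : X → ℝ) (y : X) : ℝ≥0∞ :=
  ∫⁻ z, ENNReal.ofReal (|f y - f z| ^ t) /
    (ENNReal.ofReal (dist y z ^ (s * t)) * μ (ball y (dist y z))) ∂μ


lemma aux_rpow_anti {x y : ℝ≥0∞} (h : x ≤ y) {β : ℝ} (hβ : 0 ≤ β) : y ^ (-β) ≤ x ^ (-β) := by
  rw [ENNReal.rpow_neg, ENNReal.rpow_neg, ENNReal.inv_le_inv]
  exact ENNReal.rpow_le_rpow h hβ

lemma aux_dbl_pow {μ : Measure X} {C : ℝ} (h : DoublingWith μ C) (x : X) {r : ℝ} (hr : 0 < r)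
    (n : ℕ) : μ (ball x (2 ^ n * r)) ≤ ENNReal.ofReal C ^ n * μ (ball x r) := by
  induction n with
  | zero => simp
  | succ n ih =>
    have h1 := h x (2 ^ n * r) (by positivity)
    have e : (2:ℝ) ^ (n+1) * r = 2 * (2 ^ n * r) := by ring
    rw [e, pow_succ']
    calc _ ≤ _ := h1
      _ ≤ ENNReal.ofReal C * (ENNReal.ofReal C ^ n * μ (ball x r)) := by gcongr
      _ = _ := by ring

lemma aux_bdd [Nontrivial X] (μ : Measure X) (hballs : BallsPosFinite μ) (hdbl : Doubling μ)
    (E : Set X) (hE : E.Nonempty) : BddAbove (assouadCodimBddSet μ E) := by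
  obtain ⟨C, hC, hd⟩ := hdbl
  obtain ⟨x, hx⟩ := hE
  obtain ⟨a, b, hab⟩ := exists_pair_ne X
  refine ⟨Real.logb 2 C, ?_⟩
  rintro ρ ⟨hρ0, C0, hC0, H⟩
  by_contra! hlt
  have hCρ : C < 2 ^ ρ := (Real.logb_lt_iff_lt_rpow (by norm_num) hC).1 hlt
  set R := dist a b with hR
  have hRpos : 0 < R := dist_pos.2 hab
  have hRd : ENNReal.ofReal R < 2 * EMetric.diam (univ : Set X) := by
    have h1 : ENNReal.ofReal R ≤ EMetric.diam (univ : Set X) := by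
      rw [hR, ← edist_dist]
      exact EMetric.edist_le_diam_of_mem (mem_univ _) (mem_univ _)
    calc ENNReal.ofReal R < 2 * ENNReal.ofReal R := by
          rw [two_mul]
          apply ENNReal.lt_add_right ENNReal.ofReal_ne_top
          simpa using hRpos
      _ ≤ _ := by gcongr
  have key : ∀ n : ℕ, 1 ≤ C0 * (C / 2 ^ ρ) ^ (n+1) := by
    intro n
    set r := R / 2 ^ (n+1) with hr
    have hrpos : 0 < r := by positivity
    have hrR : r < R := by
      apply div_lt_self hRpos
      exact one_lt_pow₀ (by norm_num) (by omega)
    have h1 := H x hx r R hrpos hrR hRd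
    have h2 : ball x r ⊆ {y : X | infDist y E < r} ∩ ball x R := by
      intro y hy
      exact ⟨(infDist_le_dist_of_mem hx).trans_lt hy, ball_subset_ball hrR.le hy⟩
    have h3 := aux_dbl_pow hd x hrpos (n+1)
    have e : 2 ^ (n+1) * r = R := by rw [hr]; field_simp
    rw [e] at h3
    have h4 : μ (ball x r) ≤ ENNReal.ofReal (C0 * (C / 2 ^ ρ) ^ (n+1)) * μ (ball x r) := by
      calc _ ≤ _ := measure_mono h2
        _ ≤ _ := h1
        _ ≤ ENNReal.ofReal (C0 * (r / R) ^ ρ) * (ENNReal.ofReal C ^ (n+1) * μ (ball x r)) := by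
            gcongr
        _ = _ := by
            rw [← mul_assoc, ← ENNReal.ofReal_pow hC.le, ← ENNReal.ofReal_mul (by positivity)]
            congr 2
            have : r / R = ((2:ℝ) ^ (n+1))⁻¹ := by rw [hr]; field_simp
            rw [this, Real.inv_rpow (by positivity), div_pow, ← Real.rpow_natCast 2 (n+1),
              ← Real.rpow_mul (by norm_num), ← Real.rpow_natCast (2 ^ ρ) (n+1),
              ← Real.rpow_mul (by norm_num), mul_comm ρ]
            field_simp
    obtain ⟨hp, hf⟩ := hballs x r hrpos
    by_contra! hc
    have : ENNReal.ofReal (C0 * (C / 2 ^ ρ) ^ (n+1)) * μ (ball x r) < 1 * μ (ball x r) := by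
      apply ENNReal.mul_lt_mul_left hp.ne' hf.ne
      simpa using hc
    rw [one_mul] at this
    exact absurd h4 (not_le.2 this)
  have hq0 : 0 ≤ C / 2 ^ ρ := by positivity
  have hq1 : C / 2 ^ ρ < 1 := (div_lt_one (by positivity)).2 hCρ
  obtain ⟨n, hn⟩ := exists_pow_lt_of_lt_one (show 0 < 1 / C0 by positivity) hq1
  have h1 := key n
  have h2 : (C / 2 ^ ρ) ^ (n+1) ≤ (C / 2 ^ ρ) ^ n :=
    pow_le_pow_of_le_one hq0 hq1.le (by omega)
  have h3 : (C / 2 ^ ρ) ^ (n+1) * C0 < 1 := by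
    rw [← lt_div_iff₀ (by positivity)]; linarith
  linarith

lemma aux_key (μ : Measure X) (hballs : BallsPosFinite μ) (hdbl : Doubling μ)
    (E : Set X) (c : ℝ) (hc : 0 < c)
    (hpor : ∀ x ∈ E, ∀ r : ℝ, 0 < r →
      ENNReal.ofReal r < 2 * EMetric.diam (univ : Set X) →
      ∃ y : X, ball y (c * r) ⊆ ball x r \ E)
    (α p : ℝ) (hα : α < 0) (hp : 1 < p)
    (hw : MemAp μ (distWeight E α) p) :
    ∃ K : ℝ, 1 ≤ K ∧ ∀ z ∈ E, ∀ ρ : ℝ, 0 < ρ →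
      ENNReal.ofReal ρ < 2 * EMetric.diam (univ : Set X) →
      ∫⁻ y in ball z (8 * ρ), ENNReal.ofReal (infDist y E) ^ (-(α / (1 - p))) ∂μ ≤
        ENNReal.ofReal K * ∫⁻ y in ball z ρ ∩ {y | c / 2 * ρ ≤ infDist y E},
          ENNReal.ofReal (infDist y E) ^ (-(α / (1 - p))) ∂μ := by
  obtain ⟨-, A, hA, hAp⟩ := hw
  obtain ⟨C, hC, hd⟩ := hdbl
  set β := α / (1 - p) with hβ
  have hp1 : 0 < p - 1 := by linarith
  have hβpos : 0 < β := div_pos_of_neg_of_neg hα (by linarith)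
  obtain ⟨n, hn⟩ := pow_unbounded_of_one_lt (9 * (2 / c)) (one_lt_two)
  set D := ENNReal.ofReal C ^ n with hD
  have hD0 : D ≠ 0 := by simp [hD, hC]
  have hDt : D ≠ ∞ := by simp [hD]
  set M := (ENNReal.ofReal A * D) ^ (p - 1)⁻¹ with hM
  have hMt : M ≠ ∞ := by
    apply ENNReal.rpow_ne_top_of_nonneg (by positivity)
    exact ENNReal.mul_ne_top (by simp) hDt
  set K := M * D * ENNReal.ofReal (c / 2) ^ (-β) with hK
  have hKt : K ≠ ∞ := by
    refine ENNReal.mul_ne_top (ENNReal.mul_ne_top hMt hDt) ?_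
    apply ENNReal.rpow_ne_top_of_ne_zero
    · simpa using hc
    · simp
  refine ⟨max 1 K.toReal, le_max_left _ _, ?_⟩
  intro z hz ρ hρ hρd
  obtain ⟨y, hy⟩ := hpor z hz ρ hρ hρd
  set s := c / 2 * ρ with hs
  have hspos : 0 < s := by positivity
  have hyz : dist y z < ρ := (hy (mem_ball_self (by positivity))).1
  have hP1 : ball y s ⊆ ball z ρ ∩ {u | s ≤ infDist u E} := by
    intro u hu
    have hu' : dist u y < s := hu
    refine ⟨(hy (ball_subset_ball (by rw [hs]; nlinarith) hu)).1, ?_⟩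
    refine (le_infDist ⟨z, hz⟩).2 fun e he => ?_
    have h1 : c * ρ ≤ dist e y := by
      by_contra! h
      exact (hy (show e ∈ ball y (c * ρ) from h)).2 he
    have h2 := dist_triangle e u y
    rw [dist_comm e u] at h2
    have : c * ρ = s + s := by rw [hs]; ring
    linarith
  have hmB : μ (ball z (8 * ρ)) ≤ D * μ (ball y s) := by
    refine le_trans (measure_mono ?_) (aux_dbl_pow hd y hspos n)
    intro u hu
    have hu' : dist u z < 8 * ρ := hu
    have h2 := dist_triangle u z y
    rw [dist_comm z y] at h2
    have h3 : 9 * ρ ≤ 2 ^ n * s := by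
      have : 9 * ρ = 9 * (2 / c) * s := by rw [hs]; field_simp
      rw [this]; gcongr
    show dist u y < _
    linarith
  obtain ⟨hB0, hBt⟩ := hballs z (8 * ρ) (by positivity)
  set B := ball z (8 * ρ) with hB
  set V := ∫⁻ u in B, ENNReal.ofReal (infDist u E) ^ (-β) ∂μ with hV
  have hA1 := hAp z (8 * ρ) (by positivity)
  rw [← hB] at hA1
  have hv : ∀ u, distWeight E α u ^ (-(1 / (p - 1))) = ENNReal.ofReal (infDist u E) ^ (-β) := by
    intro u
    rw [distWeight, ← ENNReal.rpow_mul]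
    congr 1
    rw [hβ]
    have : 1 - p ≠ 0 := by linarith
    field_simp
    ring
  simp_rw [hv] at hA1
  rw [← hV] at hA1
  have hW : ENNReal.ofReal s ^ (-α) * μ (ball y s) ≤ ∫⁻ u in B, distWeight E α u ∂μ := by
    calc _ = ∫⁻ u in ball y s, ENNReal.ofReal s ^ (-α) ∂μ := by rw [setLIntegral_const]
      _ ≤ ∫⁻ u in ball y s, distWeight E α u ∂μ := by
          apply setLIntegral_mono' measurableSet_ball
          intro u hu
          exact ENNReal.rpow_le_rpow (ENNReal.ofReal_le_ofReal (hP1 hu).2) (by linarith)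
      _ ≤ _ := lintegral_mono_set (hP1.trans (inter_subset_left.trans
          (ball_subset_ball (by linarith))))
  have hs0 : ENNReal.ofReal s ≠ 0 := by simpa using hspos
  have hW2 : ENNReal.ofReal s ^ (-α) ≤ D * ((∫⁻ u in B, distWeight E α u ∂μ) / μ B) := by
    rw [← mul_div_assoc, ENNReal.le_div_iff_mul_le (Or.inl hB0.ne') (Or.inl hBt.ne)]
    calc _ ≤ ENNReal.ofReal s ^ (-α) * (D * μ (ball y s)) := by gcongr
      _ = D * (ENNReal.ofReal s ^ (-α) * μ (ball y s)) := by ring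
      _ ≤ _ := by gcongr
  have h1 : (V / μ B) ^ (p - 1) * ENNReal.ofReal s ^ (-α) ≤ ENNReal.ofReal A * D := by
    calc _ ≤ (V / μ B) ^ (p - 1) * (D * ((∫⁻ u in B, distWeight E α u ∂μ) / μ B)) := by gcongr
      _ = ((∫⁻ u in B, distWeight E α u ∂μ) / μ B) * (V / μ B) ^ (p - 1) * D := by ring
      _ ≤ _ := by gcongr
  have h2 : V / μ B * ENNReal.ofReal s ^ β ≤ M := by
    rw [hM, ENNReal.le_rpow_inv_iff hp1, ENNReal.mul_rpow_of_nonneg _ _ hp1.le,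
      ← ENNReal.rpow_mul]
    convert h1 using 3
    rw [hβ]
    have : 1 - p ≠ 0 := by linarith
    field_simp
    ring
  have hsb0 : ENNReal.ofReal s ^ β ≠ 0 := by
    rw [ENNReal.ofReal_rpow_of_pos hspos]; simp; positivity
  have hsbt : ENNReal.ofReal s ^ β ≠ ∞ := ENNReal.rpow_ne_top_of_nonneg hβpos.le (by simp)
  have h3 : V ≤ M * ENNReal.ofReal s ^ (-β) * μ B := by
    rw [← ENNReal.div_le_iff hB0.ne' hBt.ne, ENNReal.rpow_neg, ← div_eq_mul_inv,
      ENNReal.le_div_iff_mul_le (Or.inl hsb0) (Or.inl hsbt)]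
    exact h2
  have h4 : ENNReal.ofReal ρ ^ (-β) * μ (ball y s) ≤
      ∫⁻ u in ball z ρ ∩ {u | s ≤ infDist u E}, ENNReal.ofReal (infDist u E) ^ (-β) ∂μ := by
    calc _ = ∫⁻ u in ball y s, ENNReal.ofReal ρ ^ (-β) ∂μ := by rw [setLIntegral_const]
      _ ≤ ∫⁻ u in ball y s, ENNReal.ofReal (infDist u E) ^ (-β) ∂μ := by
          apply setLIntegral_mono' measurableSet_ball
          intro u hu
          apply aux_rpow_anti (ENNReal.ofReal_le_ofReal _) hβpos.le
          exact (infDist_le_dist_of_mem hz).trans (le_of_lt (hP1 hu).1)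
      _ ≤ _ := lintegral_mono_set hP1
  have hKK : K ≤ ENNReal.ofReal (max 1 K.toReal) := by
    rw [← ENNReal.ofReal_toReal hKt]
    apply ENNReal.ofReal_le_ofReal
    rw [ENNReal.ofReal_toReal hKt]
    exact le_max_right _ _
  calc V ≤ M * ENNReal.ofReal s ^ (-β) * μ B := h3
    _ ≤ M * ENNReal.ofReal s ^ (-β) * (D * μ (ball y s)) := by gcongr
    _ = K * (ENNReal.ofReal ρ ^ (-β) * μ (ball y s)) := by
        rw [hs, ENNReal.ofReal_mul (by positivity), ENNReal.mul_rpow_of_ne_top (by simp) (by simp),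
          hK]
        ring
    _ ≤ _ := by gcongr

lemma aux_decay (μ : Measure X) (hballs : BallsPosFinite μ)
    (E : Set X) (c : ℝ) (hc : 0 < c) (hc1 : c < 1) (v : X → ℝ≥0∞) (K : ℝ) (hK : 1 ≤ K)
    (H : ∀ z ∈ E, ∀ ρ : ℝ, 0 < ρ →
      ENNReal.ofReal ρ < 2 * EMetric.diam (univ : Set X) →
      ∫⁻ y in ball z (8 * ρ), v y ∂μ ≤
        ENNReal.ofReal K * ∫⁻ y in ball z ρ ∩ {y | c / 2 * ρ ≤ infDist y E}, v y ∂μ)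
    (x : X) (hx : x ∈ E) (R t : ℝ) (hR : 0 < R) (ht : 0 < t)
    (htd : ENNReal.ofReal t < 2 * EMetric.diam (univ : Set X)) :
    ∫⁻ y in {y | infDist y E < c / 2 * t} ∩ ball x (R + 4 * (c / 2 * t)), v y ∂μ ≤
      ENNReal.ofReal (K / (1 + K)) * ∫⁻ y in {y | infDist y E < t} ∩ ball x (R + 4 * t), v y ∂μ := by
  set s := c / 2 * t with hs
  have hspos : 0 < s := by positivity
  have hst : s < t / 2 := by rw [hs]; nlinarith
  obtain ⟨u, hut, hudisj, hucov⟩ :=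
    Vitali.exists_disjoint_subfamily_covering_enlargement_closedBall
      (E ∩ ball x (R + 5 * s)) (fun z : X => z) (fun _ => t) t (fun _ _ => le_rfl) 5 (by norm_num)
  have hdisj : u.PairwiseDisjoint (fun z => ball z t) :=
    hudisj.mono fun z => ball_subset_closedBall
  have hsubB : ∀ z ∈ u, ball z t ⊆ ball x (R + 4 * t) := by
    intro z hz y hy
    have h1 : dist z x < R + 5 * s := (hut hz).2
    have h2 : dist y z < t := hy
    have h3 := dist_triangle y z x
    show dist y x < _
    linarith
  have hcount : u.Countable := by
    have h := Measure.countable_meas_pos_of_disjoint_of_meas_iUnion_ne_top μ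
      (As := fun z : u => ball (z : X) t) (fun _ => measurableSet_ball)
      (hdisj.subtype _ _)
      (ne_top_of_le_ne_top (hballs x (R + 4 * t) (by positivity)).2.ne
        (measure_mono (iUnion_subset fun z => hsubB z z.2)))
    have h' : {i : u | 0 < μ (ball (i : X) t)} = univ := by
      ext i; simp [(hballs i t ht).1]
    rw [h', countable_univ_iff] at h
    exact h
  have : Countable u := hcount
  set G := {y | infDist y E < s} ∩ ball x (R + 4 * s) with hG
  set F := {y | infDist y E < t} ∩ ball x (R + 4 * t) with hF
  set N : X → Set X := fun z => ball z t ∩ {y | s ≤ infDist y E} with hN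
  have hNm : ∀ z, MeasurableSet (N z) := fun z =>
    measurableSet_ball.inter (measurableSet_le measurable_const measurable_infDist)
  have hcov : G ⊆ ⋃ z : u, ball (z : X) (8 * t) := by
    rintro y ⟨hy1, hy2⟩
    obtain ⟨e, he, hye⟩ := (infDist_lt_iff ⟨x, hx⟩).1 hy1
    have hy2' : dist y x < R + 4 * s := hy2
    have hex : e ∈ E ∩ ball x (R + 5 * s) := by
      refine ⟨he, ?_⟩
      have h3 := dist_triangle e y x
      rw [dist_comm e y] at h3
      show dist e x < _
      linarith
    obtain ⟨b, hb, hsub⟩ := hucov e hex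
    have hyb : y ∈ closedBall b (5 * t) := hsub (show dist y e ≤ t by linarith)
    have hyb' : dist y b ≤ 5 * t := hyb
    refine mem_iUnion.2 ⟨⟨b, hb⟩, ?_⟩
    show dist y b < 8 * t
    linarith
  set U := ⋃ z : u, N z with hU
  have hUm : MeasurableSet U := MeasurableSet.iUnion fun z => hNm z
  have h1 : ∫⁻ y in G, v y ∂μ ≤ ENNReal.ofReal K * ∫⁻ y in U, v y ∂μ := by
    calc _ ≤ ∫⁻ y in ⋃ z : u, ball (z : X) (8 * t), v y ∂μ := lintegral_mono_set hcov
      _ ≤ ∑' z : u, ∫⁻ y in ball (z : X) (8 * t), v y ∂μ := lintegral_iUnion_le _ _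
      _ ≤ ∑' z : u, ENNReal.ofReal K * ∫⁻ y in N z, v y ∂μ :=
          ENNReal.tsum_le_tsum fun z => H z (hut z.2).1 t ht htd
      _ = ENNReal.ofReal K * ∑' z : u, ∫⁻ y in N z, v y ∂μ := ENNReal.tsum_mul_left
      _ = _ := by
          rw [hU, lintegral_iUnion (fun z : u => hNm z)]
          intro a b hab
          exact (hdisj.subtype _ _ hab).mono inter_subset_left inter_subset_left
  have h2 : ∫⁻ y in G, v y ∂μ + ∫⁻ y in U, v y ∂μ ≤ ∫⁻ y in F, v y ∂μ := by
    rw [← lintegral_union hUm]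
    · apply lintegral_mono_set
      apply union_subset
      · rintro y ⟨hy1, hy2⟩
        have hy1' : infDist y E < s := hy1
        refine ⟨show infDist y E < t by linarith, ball_subset_ball (by linarith) hy2⟩
      · refine iUnion_subset fun z => ?_
        rintro y ⟨hy1, hy2⟩
        exact ⟨(infDist_le_dist_of_mem (hut z.2).1).trans_lt hy1, hsubB z z.2 hy1⟩
    · rw [Set.disjoint_left]
      rintro y ⟨hy1, -⟩ hy
      obtain ⟨z, hz⟩ := mem_iUnion.1 hy
      exact not_lt_of_ge (show s ≤ infDist y E from hz.2) hy1
  have h3 : (∫⁻ y in G, v y ∂μ) * ENNReal.ofReal (1 + K) ≤ ENNReal.ofReal K * ∫⁻ y in F, v y ∂μ := by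
    rw [ENNReal.ofReal_add (by norm_num) (by linarith), ENNReal.ofReal_one, mul_add, mul_one]
    calc _ ≤ ENNReal.ofReal K * ∫⁻ y in U, v y ∂μ + (∫⁻ y in G, v y ∂μ) * ENNReal.ofReal K := by
          gcongr
      _ = ENNReal.ofReal K * (∫⁻ y in G, v y ∂μ + ∫⁻ y in U, v y ∂μ) := by ring
      _ ≤ _ := by gcongr
  rw [ENNReal.ofReal_div_of_pos (by linarith), ENNReal.mul_comm_div, ← mul_div_assoc,
    ENNReal.le_div_iff_mul_le (Or.inl (by simp; linarith)) (Or.inl (by simp))]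
  exact h3

lemma aux_main [Nontrivial X]
    (μ : Measure X) (hballs : BallsPosFinite μ) (hdbl : Doubling μ)
    (E : Set X) (hE : E.Nonempty) (hpor : IsPorous E)
    (α p : ℝ) (hα : α < 0) (hp : 1 < p)
    (hw : MemAp μ (distWeight E α) p) :
    α / (1 - p) < assouadCodim μ E := by
  obtain ⟨c, hc, hc1, hpor⟩ := hpor
  obtain ⟨K, hK, H⟩ := aux_key μ hballs hdbl E c hc hpor α p hα hp hw
  set β := α / (1 - p) with hβ
  have hβpos : 0 < β := div_pos_of_neg_of_neg hα (by linarith)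
  set η := c / 2 with hη
  have hη0 : 0 < η := by positivity
  have hη1 : η < 1 := by linarith
  set θ := K / (1 + K) with hθ
  have hθ0 : 0 < θ := by positivity
  have hθ1 : θ < 1 := by rw [hθ, div_lt_one (by linarith)]; linarith
  set ε := Real.log θ / Real.log η with hε
  have hlη : Real.log η < 0 := Real.log_neg hη0 hη1
  have hε0 : 0 < ε := div_pos_of_neg_of_neg (Real.log_neg hθ0 hθ1) hlη
  have hηε : η ^ ε = θ := by
    rw [Real.rpow_def_of_pos hη0, hε, mul_div_cancel₀ _ hlη.ne, Real.exp_log hθ0]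
  suffices hmem : β + ε ∈ assouadCodimBddSet μ E by
    have := le_csSup (aux_bdd μ hballs hdbl E hE) hmem
    unfold assouadCodim
    linarith
  set C1 := K * η ^ (-β) * θ⁻¹ with hC1
  have hC10 : 0 < C1 := by positivity
  refine ⟨by positivity, max 1 C1, le_max_left _ _, ?_⟩
  intro x hx r R hr hrR hRd
  have hR : 0 < R := hr.trans hrR
  set v : X → ℝ≥0∞ := fun y => ENNReal.ofReal (infDist y E) ^ (-β) with hv
  set b : ℝ → ℝ≥0∞ := fun t => ∫⁻ y in {y | infDist y E < t} ∩ ball x (R + 4 * t), v y ∂μ with hb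
  have hdec : ∀ k : ℕ, b (η ^ k * R) ≤ ENNReal.ofReal (θ ^ k) * b R := by
    intro k
    induction k with
    | zero => simp
    | succ k ih =>
      have hk : ENNReal.ofReal (η ^ k * R) < 2 * EMetric.diam (univ : Set X) := by
        refine lt_of_le_of_lt (ENNReal.ofReal_le_ofReal ?_) hRd
        exact mul_le_of_le_one_left hR.le (pow_le_one₀ hη0.le hη1.le)
      have := aux_decay μ hballs E c hc hc1 v K hK H x hx R (η ^ k * R) hR (by positivity) hk
      have e : η ^ (k+1) * R = c / 2 * (η ^ k * R) := by rw [← hη]; ring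
      rw [e]
      calc b (c / 2 * (η ^ k * R)) ≤ ENNReal.ofReal θ * b (η ^ k * R) := this
        _ ≤ ENNReal.ofReal θ * (ENNReal.ofReal (θ ^ k) * b R) := by gcongr
        _ = _ := by rw [pow_succ', ENNReal.ofReal_mul hθ0.le, mul_assoc]
  have hbR : b R ≤ ENNReal.ofReal K * (ENNReal.ofReal (η * R) ^ (-β) * μ (ball x R)) := by
    calc b R ≤ ∫⁻ y in ball x (8 * R), v y ∂μ :=
          lintegral_mono_set (inter_subset_right.trans (ball_subset_ball (by linarith)))
      _ ≤ _ := H x hx R hR hRd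
      _ ≤ _ := by
          gcongr
          calc _ ≤ ∫⁻ y in ball x R ∩ {y | η * R ≤ infDist y E}, ENNReal.ofReal (η * R) ^ (-β) ∂μ := by
                apply setLIntegral_mono'
                · exact measurableSet_ball.inter
                    (measurableSet_le measurable_const measurable_infDist)
                · intro y hy
                  exact aux_rpow_anti (ENNReal.ofReal_le_ofReal hy.2) hβpos.le
            _ ≤ _ := by
                rw [setLIntegral_const]
                gcongr
                exact inter_subset_left
  obtain ⟨k, hk1, hk2⟩ := exists_nat_pow_near_of_lt_one (show 0 < r / R by positivity)
    ((div_le_one hR).2 hrR.le) hη0 hη1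
  have hrk : r ≤ η ^ k * R := (div_le_iff₀ hR).1 hk2
  have hθk : θ ^ k ≤ θ⁻¹ * (r / R) ^ ε := by
    have h1 : (η ^ (k+1)) ^ ε ≤ (r / R) ^ ε := Real.rpow_le_rpow (by positivity) hk1.le hε0.le
    have h2 : (η ^ (k+1)) ^ ε = θ ^ (k+1) := by
      rw [← hηε, ← Real.rpow_natCast, ← Real.rpow_natCast, ← Real.rpow_mul hη0.le,
        ← Real.rpow_mul hη0.le, mul_comm]
    rw [h2] at h1
    calc θ ^ k = θ⁻¹ * θ ^ (k+1) := by rw [pow_succ']; field_simp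
      _ ≤ _ := by gcongr
  have hfin : ENNReal.ofReal (r ^ (-β)) * μ ({y : X | infDist y E < r} ∩ ball x R) ≤
      ENNReal.ofReal (θ ^ k * (K * (η * R) ^ (-β))) * μ (ball x R) := by
    calc _ = ∫⁻ y in {y : X | infDist y E < r} ∩ ball x R, ENNReal.ofReal r ^ (-β) ∂μ := by
          rw [setLIntegral_const, ENNReal.ofReal_rpow_of_pos hr]
      _ ≤ ∫⁻ y in {y : X | infDist y E < r} ∩ ball x R, v y ∂μ := by
          apply setLIntegral_mono'
          · exact (measurableSet_lt measurable_infDist measurable_const).inter measurableSet_ball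
          · intro y hy
            exact aux_rpow_anti (ENNReal.ofReal_le_ofReal (le_of_lt hy.1)) hβpos.le
      _ ≤ b (η ^ k * R) := by
          apply lintegral_mono_set
          rintro y ⟨hy1, hy2⟩
          exact ⟨lt_of_lt_of_le hy1 hrk,
            ball_subset_ball (by have : 0 < η ^ k * R := by positivity
                                 linarith) hy2⟩
      _ ≤ _ := hdec k
      _ ≤ ENNReal.ofReal (θ ^ k) *
          (ENNReal.ofReal K * (ENNReal.ofReal (η * R) ^ (-β) * μ (ball x R))) := by gcongr
      _ = _ := by
          rw [ENNReal.ofReal_rpow_of_pos (by positivity), ENNReal.ofReal_mul (by positivity),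
            ENNReal.ofReal_mul (by positivity)]
          ring
  have hcancel : ENNReal.ofReal (r ^ β) * ENNReal.ofReal (r ^ (-β)) = 1 := by
    rw [← ENNReal.ofReal_mul (by positivity), ← Real.rpow_add hr]; simp
  calc μ ({y : X | infDist y E < r} ∩ ball x R)
      = ENNReal.ofReal (r ^ β) *
        (ENNReal.ofReal (r ^ (-β)) * μ ({y : X | infDist y E < r} ∩ ball x R)) := by
        rw [← mul_assoc, hcancel, one_mul]
    _ ≤ ENNReal.ofReal (r ^ β) *
        (ENNReal.ofReal (θ ^ k * (K * (η * R) ^ (-β))) * μ (ball x R)) := by gcongr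
    _ = ENNReal.ofReal (r ^ β * (θ ^ k * (K * (η * R) ^ (-β)))) * μ (ball x R) := by
        rw [← mul_assoc, ← ENNReal.ofReal_mul (by positivity)]
    _ ≤ ENNReal.ofReal (max 1 C1 * (r / R) ^ (β + ε)) * μ (ball x R) := by
        refine mul_le_mul_left (ENNReal.ofReal_le_ofReal ?_) _
        calc r ^ β * (θ ^ k * (K * (η * R) ^ (-β)))
            ≤ r ^ β * ((θ⁻¹ * (r / R) ^ ε) * (K * (η * R) ^ (-β))) := by gcongr
          _ = C1 * (r / R) ^ (β + ε) := by
              rw [Real.mul_rpow hη0.le hR.le, Real.rpow_add (by positivity),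
                Real.div_rpow hr.le hR.le β, Real.rpow_neg hR.le, hC1]
              ring
          _ ≤ _ := mul_le_mul_of_nonneg_right (le_max_right _ _) (by positivity)

theorem codim_gt_of_distWeight_memAp [Nontrivial X]
    (μ : Measure X) (hballs : BallsPosFinite μ) (hdbl : Doubling μ)
    (E : Set X) (hE : E.Nonempty) (hEc : IsClosed E) (hpor : IsPorous E)
    (α p : ℝ) (hα : α < 0) (hp : 1 < p)
    (hw : MemAp μ (distWeight E α) p) :
    α / (1 - p) < assouadCodim μ E := by
  exact aux_main μ hballs hdbl E hE hpor α p hα hp hw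

end
end ApDistance
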